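/- For every angle θ with 0 < θ ≤ 0.0664·π, there exists a test path q ∈ P(Q_S, Q_{E₂}) whose action satisfies A(q) < (3/8)·16^{1/3}·[ π^{2/3} + θ^{2/3} + 2·(2θ)^{2/3} ]. -/

import Mathlib

open Real MeasureTheory Set
open scoped ENNReal

noncomputable section

/-- Euclidean norm on `ℝ × ℝ` (row vectors in the plane). -/
def enorm2 (v : ℝ × ℝ) : ℝ := Real.sqrt (v.1 ^ 2 + v.2 ^ 2)

/-- Row vector multiplied on the right by the rotation matrix `R θ`
with rows `(cos θ, sin θ)` and `(-sin θ, cos θ)`. -/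
def rotV (θ : ℝ) (v : ℝ × ℝ) : ℝ × ℝ :=
  (v.1 * Real.cos θ - v.2 * Real.sin θ, v.1 * Real.sin θ + v.2 * Real.cos θ)

/-- `H¹([0,1],(ℝ²)⁴)`: absolutely continuous paths `[0,1] → (ℝ²)⁴` with
square-integrable derivative, recorded via an integrable (a.e.-)derivative `v`
together with the integral representation of `q`. -/
structure H1Path4 where
  q : ℝ → Fin 4 → ℝ × ℝ
  v : ℝ → Fin 4 → ℝ × ℝ
  hvInt : ∀ i : Fin 4, IntegrableOn (fun t => v t i) (Icc (0:ℝ) 1)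
  hrep : ∀ i : Fin 4, ∀ t ∈ Icc (0:ℝ) 1, q t i = q 0 i + ∫ s in (0:ℝ)..t, v s i
  hL2 : ∀ i : Fin 4, IntegrableOn (fun t => enorm2 (v t i) ^ 2) (Icc (0:ℝ) 1)

/-- Center of mass at the origin throughout `[0,1]` (the path lies in `χ`). -/
def H1Path4.inChi (p : H1Path4) : Prop := ∀ t ∈ Icc (0:ℝ) 1, ∑ i, p.q t i = 0

/-- The Lagrangian action functional `A`, with value `+∞` allowed. -/
def action (p : H1Path4) : ℝ≥0∞ :=
  ∫⁻ t in Icc (0:ℝ) 1,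
    (ENNReal.ofReal ((1/2) * ∑ i, enorm2 (p.v t i) ^ 2)
      + ∑ i : Fin 4, ∑ j ∈ Finset.univ.filter (fun j => i < j),
          (ENNReal.ofReal (enorm2 (p.q t i - p.q t j)))⁻¹)

/-- The starting boundary configuration set `Q_S` (double isosceles with order
constraints). -/
def QSset : Set (Fin 4 → ℝ × ℝ) :=
  { c | ∃ a₁ b₁ c₁ : ℝ, 0 ≤ b₁ ∧ 0 ≤ c₁ ∧
      c = ![(-a₁ - c₁, 0), (-a₁, 0), ((2*a₁ + c₁)/2, b₁), ((2*a₁ + c₁)/2, -b₁)] }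

/-- The ending boundary configuration set `Q_{E₁}`. -/
def QE1set (θ : ℝ) : Set (Fin 4 → ℝ × ℝ) :=
  { c | ∃ a₂ b₂ c₂ : ℝ, 0 ≤ b₂ ∧ 0 ≤ c₂ ∧
      c = fun i => rotV θ (![(-b₂, -a₂), (-c₂, a₂), (c₂, a₂), (b₂, -a₂)] i) }

/-- The ending boundary configuration set `Q_{E₂}`. -/
def QE2set (θ : ℝ) : Set (Fin 4 → ℝ × ℝ) :=
  { c | ∃ a₂ b₂ c₂ : ℝ, 0 ≤ b₂ ∧ 0 ≤ c₂ ∧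
      c = fun i => rotV θ (![(-a₂, -b₂), (-a₂, b₂), (a₂, c₂), (a₂, -c₂)] i) }

/-- Membership in the admissible class `P(Q_S, E)`. -/
def inAdm (E : Set (Fin 4 → ℝ × ℝ)) (p : H1Path4) : Prop :=
  p.inChi ∧ p.q 0 ∈ QSset ∧ p.q 1 ∈ E

/-- `p` is an action minimizer over `P(Q_S, E)`. -/
def isMin (E : Set (Fin 4 → ℝ × ℝ)) (p : H1Path4) : Prop :=
  inAdm E p ∧ ∀ p' : H1Path4, inAdm E p' → action p ≤ action p'

/-- The Newtonian equations of the equal-mass four-body problem, on a set `s`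
of times. -/
def newton (Q : ℝ → Fin 4 → ℝ × ℝ) (s : Set ℝ) : Prop :=
  ∀ i : Fin 4, ∀ t ∈ s,
    deriv (deriv (fun u => Q u i)) t =
      ∑ j ∈ Finset.univ.erase i, (1 / enorm2 (Q t j - Q t i) ^ 3) • (Q t j - Q t i)

lemma enorm2_sq (v : ℝ × ℝ) : enorm2 v ^ 2 = v.1 ^ 2 + v.2 ^ 2 :=
  Real.sq_sqrt (by positivity)

/-- A continuously differentiable path, as an element of `H¹`. -/
def H1Path4.ofHasDerivAt (q v : ℝ → Fin 4 → ℝ × ℝ) (hv : ∀ i, Continuous fun t => v t i)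
    (hq : ∀ i t, HasDerivAt (fun s => q s i) (v t i) t) : H1Path4 where
  q := q
  v := v
  hvInt i := (hv i).continuousOn.integrableOn_Icc
  hrep i t _ := by
    rw [intervalIntegral.integral_eq_sub_of_hasDerivAt (fun s _ => hq i s)
      ((hv i).intervalIntegrable _ _)]
    abel
  hL2 i := by
    simp only [enorm2_sq]
    have := hv i
    exact Continuous.integrableOn_Icc (by fun_prop)

/-- Positions of two bodies forming a circular binary of diameter `R` and angular velocity `φ`;
its centre and the other two bodies form an equilateral triangle of side `r` rotating
with angular velocity `θ`. -/
def binaryTriangle (θ φ r R t : ℝ) : Fin 4 → ℝ × ℝ :=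
  ![(-(√3 / 4 * r) * cos (θ * t) - R / 2 * cos (φ * t),
      -(√3 / 4 * r) * sin (θ * t) - R / 2 * sin (φ * t)),
    (-(√3 / 4 * r) * cos (θ * t) + R / 2 * cos (φ * t),
      -(√3 / 4 * r) * sin (θ * t) + R / 2 * sin (φ * t)),
    (√3 / 4 * r * cos (θ * t) - r / 2 * sin (θ * t),
      √3 / 4 * r * sin (θ * t) + r / 2 * cos (θ * t)),
    (√3 / 4 * r * cos (θ * t) + r / 2 * sin (θ * t),
      √3 / 4 * r * sin (θ * t) - r / 2 * cos (θ * t))]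

/-- The velocities of `binaryTriangle`. -/
def binaryTriangleVel (θ φ r R t : ℝ) : Fin 4 → ℝ × ℝ :=
  ![(√3 / 4 * r * (θ * sin (θ * t)) + R / 2 * (φ * sin (φ * t)),
      -(√3 / 4 * r) * (θ * cos (θ * t)) - R / 2 * (φ * cos (φ * t))),
    (√3 / 4 * r * (θ * sin (θ * t)) - R / 2 * (φ * sin (φ * t)),
      -(√3 / 4 * r) * (θ * cos (θ * t)) + R / 2 * (φ * cos (φ * t))),
    (-(√3 / 4 * r) * (θ * sin (θ * t)) - r / 2 * (θ * cos (θ * t)),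
      √3 / 4 * r * (θ * cos (θ * t)) - r / 2 * (θ * sin (θ * t))),
    (-(√3 / 4 * r) * (θ * sin (θ * t)) + r / 2 * (θ * cos (θ * t)),
      √3 / 4 * r * (θ * cos (θ * t)) + r / 2 * (θ * sin (θ * t)))]

lemma continuous_binaryTriangleVel (θ φ r R : ℝ) (i : Fin 4) :
    Continuous fun t => binaryTriangleVel θ φ r R t i := by
  fin_cases i <;> simp only [binaryTriangleVel] <;>
    exact Continuous.prodMk (by fun_prop) (by fun_prop)

lemma hasDerivAt_binaryTriangle (θ φ r R : ℝ) (i : Fin 4) (t : ℝ) :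
    HasDerivAt (fun s => binaryTriangle θ φ r R s i) (binaryTriangleVel θ φ r R t i) t := by
  have hc (ω : ℝ) : HasDerivAt (fun s => cos (ω * s)) (-(ω * sin (ω * t))) t := by
    exact ((hasDerivAt_id t).const_mul ω).cos.congr_deriv (by simp; ring)
  have hs (ω : ℝ) : HasDerivAt (fun s => sin (ω * s)) (ω * cos (ω * t)) t := by
    exact ((hasDerivAt_id t).const_mul ω).sin.congr_deriv (by simp; ring)
  fin_cases i
  · refine HasDerivAt.prodMk ?_ ?_
    · exact (((hc θ).const_mul (-(√3 / 4 * r))).sub ((hc φ).const_mul (R / 2))).congr_deriv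
        (by ring)
    · exact ((hs θ).const_mul (-(√3 / 4 * r))).sub ((hs φ).const_mul (R / 2))
  · refine HasDerivAt.prodMk ?_ ?_
    · exact (((hc θ).const_mul (-(√3 / 4 * r))).add ((hc φ).const_mul (R / 2))).congr_deriv
        (by ring)
    · exact ((hs θ).const_mul (-(√3 / 4 * r))).add ((hs φ).const_mul (R / 2))
  · refine HasDerivAt.prodMk ?_ ?_
    · exact (((hc θ).const_mul (√3 / 4 * r)).sub ((hs θ).const_mul (r / 2))).congr_deriv
        (by ring)
    · exact (((hs θ).const_mul (√3 / 4 * r)).add ((hc θ).const_mul (r / 2))).congr_deriv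
        (by ring)
  · refine HasDerivAt.prodMk ?_ ?_
    · exact (((hc θ).const_mul (√3 / 4 * r)).add ((hs θ).const_mul (r / 2))).congr_deriv
        (by ring)
    · exact (((hs θ).const_mul (√3 / 4 * r)).sub ((hc θ).const_mul (r / 2))).congr_deriv
        (by ring)

/-- The motion `binaryTriangle` as an `H¹` path. -/
def binaryTrianglePath (θ φ r R : ℝ) : H1Path4 :=
  .ofHasDerivAt (binaryTriangle θ φ r R) (binaryTriangleVel θ φ r R)
    (continuous_binaryTriangleVel θ φ r R) (hasDerivAt_binaryTriangle θ φ r R)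

lemma inAdm_binaryTrianglePath (θ : ℝ) {r R : ℝ} (hr : 0 ≤ r) (hR : 0 ≤ R) :
    inAdm (QE2set θ) (binaryTrianglePath θ (π / 2 + θ) r R) := by
  refine ⟨fun t _ => ?_, ⟨√3 / 4 * r - R / 2, r / 2, R, by positivity, hR, ?_⟩,
    ⟨√3 / 4 * r, R / 2, r / 2, by positivity, by positivity, ?_⟩⟩
  · simp only [binaryTrianglePath, H1Path4.ofHasDerivAt, binaryTriangle, Fin.sum_univ_four]
    ext
    · simp; ring
    · simp
  · funext i
    fin_cases i <;> ext <;>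
      simp [binaryTrianglePath, H1Path4.ofHasDerivAt, binaryTriangle] <;> ring
  · have hc : cos (π / 2 + θ) = -sin θ := by rw [add_comm, cos_add_pi_div_two]
    have hs : sin (π / 2 + θ) = cos θ := by rw [add_comm, sin_add_pi_div_two]
    funext i
    fin_cases i <;> ext <;>
      simp [binaryTrianglePath, H1Path4.ofHasDerivAt, binaryTriangle, rotV, hc, hs] <;> ring

lemma kinetic_binaryTriangleVel (θ φ r R t : ℝ) :
    1 / 2 * ∑ i, enorm2 (binaryTriangleVel θ φ r R t i) ^ 2
      = 5 / 8 * r ^ 2 * θ ^ 2 + R ^ 2 * φ ^ 2 / 4 := by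
  simp only [enorm2_sq, Fin.sum_univ_four, binaryTriangleVel, Matrix.cons_val]
  have h3 : √3 ^ 2 = 3 := Real.sq_sqrt (by norm_num)
  have h1 := sin_sq_add_cos_sq (θ * t)
  have h2 := sin_sq_add_cos_sq (φ * t)
  generalize sin (θ * t) = a at *
  generalize cos (θ * t) = b at *
  generalize sin (φ * t) = c at *
  generalize cos (φ * t) = d at *
  linear_combination (1 / 8 * r ^ 2 * θ ^ 2 * (a ^ 2 + b ^ 2)) * h3 + 5 / 8 * r ^ 2 * θ ^ 2 * h1
    + R ^ 2 * φ ^ 2 / 4 * h2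

lemma inv_sqrt_one_add_le {x : ℝ} (hx : |x| ≤ 1 / 4) :
    (√(1 + x))⁻¹ ≤ 1 - x / 2 + 3 / 8 * x ^ 2 - 5 / 16 * x ^ 3 + x ^ 4 / 2 := by
  obtain ⟨h1, h2⟩ := abs_le.1 hx
  have hP : 0 ≤ 1 - x / 2 + 3 / 8 * x ^ 2 - 5 / 16 * x ^ 3 + x ^ 4 / 2 := by
    nlinarith [sq_nonneg x, sq_nonneg (x ^ 2), mul_nonneg (sq_nonneg x) (sub_nonneg.2 h2)]
  have hpos : 0 < 1 + x := by linarith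
  have hrem : 0 ≤ 29 / 64 + 46 / 64 * x - 67 / 256 * x ^ 2 + 41 / 256 * x ^ 3 - 1 / 16 * x ^ 4
      + 1 / 4 * x ^ 5 := by
    have hx2 : x ^ 2 ≤ 1 / 16 := by nlinarith
    have hx4 : x ^ 4 ≤ 1 / 256 := by nlinarith [sq_nonneg x]
    nlinarith [mul_nonneg (sq_nonneg x) (by linarith : 0 ≤ x + 1 / 4),
      mul_nonneg (sq_nonneg (x ^ 2)) (by linarith : 0 ≤ x + 1 / 4)]
  rw [← Real.sqrt_inv]
  refine Real.sqrt_le_iff.2 ⟨hP, ?_⟩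
  rw [inv_le_iff_one_le_mul₀ hpos]
  nlinarith [mul_nonneg (sq_nonneg (x ^ 2)) hrem]

lemma inv_sqrt_add_inv_sqrt_le {s c : ℝ} (hs0 : 0 ≤ s) (hs : s ≤ 1 / 10) (hc : c ^ 2 ≤ 1) :
    (√(1 + (s ^ 2 + 2 * s * c)))⁻¹ + (√(1 + (s ^ 2 - 2 * s * c)))⁻¹
      ≤ 2 + s ^ 2 * (3 * c ^ 2 - 1) + 10 * s ^ 4 := by
  obtain ⟨hc1, hc2⟩ := abs_le.1 (sq_le_one_iff_abs_le_one c |>.1 hc)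
  have hs2 : s ^ 2 ≤ 1 / 100 := by nlinarith
  have hsc1 : s * c ≤ 1 / 10 := by nlinarith
  have hsc2 : -(1 / 10) ≤ s * c := by nlinarith
  have h1 := inv_sqrt_one_add_le (x := s ^ 2 + 2 * s * c)
    (abs_le.2 ⟨by nlinarith, by nlinarith⟩)
  have h2 := inv_sqrt_one_add_le (x := s ^ 2 - 2 * s * c)
    (abs_le.2 ⟨by nlinarith, by nlinarith⟩)
  refine (add_le_add h1 h2).trans ?_
  have hc4 : c ^ 4 ≤ c ^ 2 := by nlinarith [sq_nonneg c]
  have hs2c : s ^ 2 * c ^ 2 ≤ 1 / 100 := by nlinarith [sq_nonneg s, sq_nonneg c]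
  have hrem : 0 ≤ 37 / 4 + 15 / 2 * c ^ 2 + 5 / 8 * s ^ 2 - s ^ 4 - 24 * (s ^ 2 * c ^ 2)
      - 16 * c ^ 4 := by
    nlinarith [sq_nonneg s]
  nlinarith [mul_nonneg (sq_nonneg (s ^ 2)) hrem]

lemma one_add_sq_add_mul_pos {s c : ℝ} (hs0 : 0 ≤ s) (hs : s ≤ 1 / 10) (hc : c ^ 2 ≤ 1) :
    0 < 1 + (s ^ 2 + 2 * s * c) ∧ 0 < 1 + (s ^ 2 - 2 * s * c) := by
  obtain ⟨hc1, hc2⟩ := abs_le.1 (sq_le_one_iff_abs_le_one c |>.1 hc)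
  constructor <;> nlinarith

lemma inv_enorm2_add_inv_enorm2_le {r s c : ℝ} {v w : ℝ × ℝ} (hr : 0 < r) (hs0 : 0 ≤ s)
    (hs : s ≤ 1 / 10) (hc : c ^ 2 ≤ 1)
    (hv : v.1 ^ 2 + v.2 ^ 2 = r ^ 2 * (1 + (s ^ 2 + 2 * s * c)))
    (hw : w.1 ^ 2 + w.2 ^ 2 = r ^ 2 * (1 + (s ^ 2 - 2 * s * c))) :
    (enorm2 v)⁻¹ + (enorm2 w)⁻¹ ≤ (2 + s ^ 2 * (3 * c ^ 2 - 1) + 10 * s ^ 4) / r := by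
  have h := inv_sqrt_add_inv_sqrt_le hs0 hs hc
  rw [enorm2, enorm2, hv, hw, Real.sqrt_mul (sq_nonneg r), Real.sqrt_mul (sq_nonneg r),
    Real.sqrt_sq hr.le, mul_inv, mul_inv, ← mul_add, div_eq_inv_mul]
  gcongr

lemma enorm2_pos_of_sq {v : ℝ × ℝ} {x : ℝ} (hv : v.1 ^ 2 + v.2 ^ 2 = x) (hx : 0 < x) :
    0 < enorm2 v := Real.sqrt_pos.2 (hv ▸ hx)

lemma integrand_binaryTriangle_le (θ : ℝ) {r s : ℝ} (t : ℝ) (hr : 0 < r) (hs0 : 0 < s)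
    (hs : s ≤ 1 / 10) :
    ENNReal.ofReal (1 / 2 * ∑ i, enorm2 (binaryTriangleVel θ (π / 2 + θ) r (2 * r * s) t i) ^ 2)
      + ∑ i : Fin 4, ∑ j ∈ Finset.univ.filter (fun j => i < j),
          (ENNReal.ofReal (enorm2 (binaryTriangle θ (π / 2 + θ) r (2 * r * s) t i
            - binaryTriangle θ (π / 2 + θ) r (2 * r * s) t j)))⁻¹
    ≤ ENNReal.ofReal ((5 / 8 * r ^ 2 * θ ^ 2 + r ^ 2 * s ^ 2 * (π / 2 + θ) ^ 2)
      + (2 * r * s)⁻¹ + (5 + s ^ 2 * (1 + 3 / 2 * cos (π * t)) + 20 * s ^ 4) / r) := by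
  set φ := π / 2 + θ with hφ
  set Q := binaryTriangle θ φ r (2 * r * s) t with hQ
  have h3 : √3 ^ 2 = 3 := Real.sq_sqrt (by norm_num)
  have h1 := sin_sq_add_cos_sq (θ * t)
  have h2 := sin_sq_add_cos_sq (φ * t)
  have hψ := sin_sq_add_cos_sq (π / 2 * t)
  have hcψ : cos (π / 2 * t) = cos (φ * t) * cos (θ * t) + sin (φ * t) * sin (θ * t) := by
    rw [← cos_sub, hφ]; ring_nf
  have hsψ : sin (π / 2 * t) = sin (φ * t) * cos (θ * t) - cos (φ * t) * sin (θ * t) := by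
    rw [← sin_sub, hφ]; ring_nf
  have hc2 : cos (π * t) = 2 * cos (π / 2 * t) ^ 2 - 1 := by
    rw [← cos_two_mul]; ring_nf
  set c₃ := √3 / 2 * cos (π / 2 * t) + 1 / 2 * sin (π / 2 * t) with hc₃
  set c₄ := √3 / 2 * cos (π / 2 * t) - 1 / 2 * sin (π / 2 * t) with hc₄
  have hc₃1 : c₃ ^ 2 ≤ 1 := by
    have : c₃ ^ 2 + (1 / 2 * cos (π / 2 * t) - √3 / 2 * sin (π / 2 * t)) ^ 2 = 1 := by
      linear_combination (cos (π / 2 * t) ^ 2 + sin (π / 2 * t) ^ 2) / 4 * h3 + hψ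
    linarith [sq_nonneg (1 / 2 * cos (π / 2 * t) - √3 / 2 * sin (π / 2 * t))]
  have hc₄1 : c₄ ^ 2 ≤ 1 := by
    have : c₄ ^ 2 + (1 / 2 * cos (π / 2 * t) + √3 / 2 * sin (π / 2 * t)) ^ 2 = 1 := by
      linear_combination (cos (π / 2 * t) ^ 2 + sin (π / 2 * t) ^ 2) / 4 * h3 + hψ
    linarith [sq_nonneg (1 / 2 * cos (π / 2 * t) + √3 / 2 * sin (π / 2 * t))]
  have hsum : 3 * c₃ ^ 2 - 1 + (3 * c₄ ^ 2 - 1) = 1 + 3 / 2 * cos (π * t) := by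
    rw [hc2, hc₃, hc₄]
    linear_combination 3 / 2 * cos (π / 2 * t) ^ 2 * h3 + 3 / 2 * hψ
  have d01 : (Q 0 - Q 1).1 ^ 2 + (Q 0 - Q 1).2 ^ 2 = (2 * r * s) ^ 2 := by
    simp only [hQ, binaryTriangle, Matrix.cons_val, Prod.fst_sub, Prod.snd_sub]
    linear_combination (2 * r * s) ^ 2 * h2
  have d23 : (Q 2 - Q 3).1 ^ 2 + (Q 2 - Q 3).2 ^ 2 = r ^ 2 := by
    simp only [hQ, binaryTriangle, Matrix.cons_val, Prod.fst_sub, Prod.snd_sub]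
    linear_combination r ^ 2 * h1
  have d02 : (Q 0 - Q 2).1 ^ 2 + (Q 0 - Q 2).2 ^ 2 = r ^ 2 * (1 + (s ^ 2 + 2 * s * c₃)) := by
    simp only [hQ, binaryTriangle, Matrix.cons_val, Prod.fst_sub, Prod.snd_sub, hc₃, hcψ, hsψ]
    linear_combination r ^ 2 * s ^ 2 * h2 + r ^ 2 * h1
      + r ^ 2 / 4 * (sin (θ * t) ^ 2 + cos (θ * t) ^ 2) * h3
  have d12 : (Q 1 - Q 2).1 ^ 2 + (Q 1 - Q 2).2 ^ 2 = r ^ 2 * (1 + (s ^ 2 - 2 * s * c₃)) := by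
    simp only [hQ, binaryTriangle, Matrix.cons_val, Prod.fst_sub, Prod.snd_sub, hc₃, hcψ, hsψ]
    linear_combination r ^ 2 * s ^ 2 * h2 + r ^ 2 * h1
      + r ^ 2 / 4 * (sin (θ * t) ^ 2 + cos (θ * t) ^ 2) * h3
  have d03 : (Q 0 - Q 3).1 ^ 2 + (Q 0 - Q 3).2 ^ 2 = r ^ 2 * (1 + (s ^ 2 + 2 * s * c₄)) := by
    simp only [hQ, binaryTriangle, Matrix.cons_val, Prod.fst_sub, Prod.snd_sub, hc₄, hcψ, hsψ]
    linear_combination r ^ 2 * s ^ 2 * h2 + r ^ 2 * h1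
      + r ^ 2 / 4 * (sin (θ * t) ^ 2 + cos (θ * t) ^ 2) * h3
  have d13 : (Q 1 - Q 3).1 ^ 2 + (Q 1 - Q 3).2 ^ 2 = r ^ 2 * (1 + (s ^ 2 - 2 * s * c₄)) := by
    simp only [hQ, binaryTriangle, Matrix.cons_val, Prod.fst_sub, Prod.snd_sub, hc₄, hcψ, hsψ]
    linear_combination r ^ 2 * s ^ 2 * h2 + r ^ 2 * h1
      + r ^ 2 / 4 * (sin (θ * t) ^ 2 + cos (θ * t) ^ 2) * h3
  clear_value Q c₃ c₄
  have hpos {c : ℝ} (hc : c ^ 2 ≤ 1) :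
      0 < r ^ 2 * (1 + (s ^ 2 + 2 * s * c)) ∧ 0 < r ^ 2 * (1 + (s ^ 2 - 2 * s * c)) :=
    have h := one_add_sq_add_mul_pos hs0.le hs hc
    ⟨mul_pos (by positivity) h.1, mul_pos (by positivity) h.2⟩
  have hinv {v : ℝ × ℝ} (hv : 0 < enorm2 v) :
      (ENNReal.ofReal (enorm2 v))⁻¹ = ENNReal.ofReal (enorm2 v)⁻¹ :=
    (ENNReal.ofReal_inv_of_pos hv).symm
  have b3 := inv_enorm2_add_inv_enorm2_le hr hs0.le hs hc₃1 d02 d12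
  have b4 := inv_enorm2_add_inv_enorm2_le hr hs0.le hs hc₄1 d03 d13
  have e01 : enorm2 (Q 0 - Q 1) = 2 * r * s := by
    rw [enorm2, d01, Real.sqrt_sq (by positivity)]
  have e23 : enorm2 (Q 2 - Q 3) = r := by rw [enorm2, d23, Real.sqrt_sq hr.le]
  have f0 : Finset.univ.filter (fun j : Fin 4 => 0 < j) = {1, 2, 3} := by decide
  have f1 : Finset.univ.filter (fun j : Fin 4 => 1 < j) = {2, 3} := by decide
  have f2 : Finset.univ.filter (fun j : Fin 4 => 2 < j) = {3} := by decide
  have f3 : Finset.univ.filter (fun j : Fin 4 => 3 < j) = ∅ := by decide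
  rw [kinetic_binaryTriangleVel, Fin.sum_univ_four, f0, f1, f2, f3]
  simp only [Finset.sum_empty, Finset.sum_singleton]
  rw [Finset.sum_insert (by decide), Finset.sum_insert (by decide), Finset.sum_insert (by decide),
    Finset.sum_singleton, Finset.sum_singleton,
    hinv (enorm2_pos_of_sq d01 (by positivity)), hinv (enorm2_pos_of_sq d23 (by positivity)),
    hinv (enorm2_pos_of_sq d02 (hpos hc₃1).1), hinv (enorm2_pos_of_sq d12 (hpos hc₃1).2),
    hinv (enorm2_pos_of_sq d03 (hpos hc₄1).1), hinv (enorm2_pos_of_sq d13 (hpos hc₄1).2)]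
  have hn (v : ℝ × ℝ) : 0 ≤ (enorm2 v)⁻¹ := inv_nonneg.2 (Real.sqrt_nonneg _)
  have n01 := hn (Q 0 - Q 1)
  have n02 := hn (Q 0 - Q 2)
  have n03 := hn (Q 0 - Q 3)
  have n12 := hn (Q 1 - Q 2)
  have n13 := hn (Q 1 - Q 3)
  have n23 := hn (Q 2 - Q 3)
  rw [add_zero, ← ENNReal.ofReal_add n02 n03, ← ENNReal.ofReal_add n01 (by positivity),
    ← ENNReal.ofReal_add n12 n13, ← ENNReal.ofReal_add (by positivity) (by positivity),
    ← ENNReal.ofReal_add (by positivity) n23,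
    ← ENNReal.ofReal_add (by positivity) (by positivity)]
  refine ENNReal.ofReal_le_ofReal ?_
  rw [e01, e23]
  have : (5 + s ^ 2 * (1 + 3 / 2 * cos (π * t)) + 20 * s ^ 4) / r
      = (2 + s ^ 2 * (3 * c₃ ^ 2 - 1) + 10 * s ^ 4) / r
        + (2 + s ^ 2 * (3 * c₄ ^ 2 - 1) + 10 * s ^ 4) / r + r⁻¹ := by
    rw [← hsum]; ring
  rw [this]
  linarith

lemma action_binaryTrianglePath_le (θ : ℝ) {r s : ℝ} (hr : 0 < r) (hs0 : 0 < s)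
    (hs : s ≤ 1 / 10) :
    action (binaryTrianglePath θ (π / 2 + θ) r (2 * r * s)) ≤
      ENNReal.ofReal ((5 / 8 * r ^ 2 * θ ^ 2 + r ^ 2 * s ^ 2 * (π / 2 + θ) ^ 2)
        + (2 * r * s)⁻¹ + (5 + s ^ 2 + 20 * s ^ 4) / r) := by
  refine (lintegral_mono fun t => integrand_binaryTriangle_le θ t hr hs0 hs).trans ?_
  rw [← ofReal_integral_eq_lintegral_ofReal]
  · refine ENNReal.ofReal_le_ofReal (le_of_eq ?_)
    rw [integral_Icc_eq_integral_Ioc, ← intervalIntegral.integral_of_le zero_le_one]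
    have hcos : ∫ t in (0 : ℝ)..1, cos (π * t) = 0 := by
      rw [intervalIntegral.integral_comp_mul_left _ pi_ne_zero]
      simp
    have : ∀ t : ℝ, (5 / 8 * r ^ 2 * θ ^ 2 + r ^ 2 * s ^ 2 * (π / 2 + θ) ^ 2) + (2 * r * s)⁻¹
        + (5 + s ^ 2 * (1 + 3 / 2 * cos (π * t)) + 20 * s ^ 4) / r
        = ((5 / 8 * r ^ 2 * θ ^ 2 + r ^ 2 * s ^ 2 * (π / 2 + θ) ^ 2) + (2 * r * s)⁻¹
          + (5 + s ^ 2 + 20 * s ^ 4) / r) + s ^ 2 * (3 / 2) / r * cos (π * t) := by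
      intro t; ring
    simp only [this]
    rw [intervalIntegral.integral_add (by simp)
      (Continuous.intervalIntegrable (by fun_prop) _ _), intervalIntegral.integral_const,
      intervalIntegral.integral_const_mul, hcos]
    simp
  · exact Continuous.integrableOn_Icc (by fun_prop)
  · refine Filter.Eventually.of_forall fun t => ?_
    have := neg_one_le_cos (π * t)
    have : 0 ≤ 5 + s ^ 2 * (1 + 3 / 2 * cos (π * t)) + 20 * s ^ 4 := by
      nlinarith [sq_nonneg s, sq_nonneg (s ^ 2)]
    simp only [Pi.zero_apply]
    positivity

lemma action_bound_numeric {y : ℝ} (hy0 : 0 < y) (hy : y ^ 3 ≤ 0.0664 * π) :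
    9 / 49 * (π / 2 + y ^ 3) ^ 2 + 7 / 6 + 189 / 40 * y ^ 2
      + 5 / 8 * y ^ 2 * ((15 / 56 * y ^ 2) ^ 2 + 20 * (15 / 56 * y ^ 2) ^ 4)
      < 3 / 4 * 1.2599 * 2.145 + y ^ 2 * (3 / 4 * 1.2599 + 3) := by
  have hπ := pi_lt_d6
  have hy1 : y ≤ 0.5931 := by
    by_contra! h
    have : (0.5931 : ℝ) ^ 3 < y ^ 3 := by gcongr
    norm_num at this hy hπ
    linarith
  have h3 : (π / 2 + y ^ 3) ^ 2 ≤ (1.5707965 + 0.208602) ^ 2 := by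
    have : 0 < π := pi_pos
    gcongr
    · linarith
    · norm_num at hy hπ ⊢
      linarith
  have h2 : y ^ 2 ≤ 0.5931 ^ 2 := by gcongr
  have hs : 5 / 8 * y ^ 2 * ((15 / 56 * y ^ 2) ^ 2 + 20 * (15 / 56 * y ^ 2) ^ 4)
      ≤ 5 / 8 * 0.5931 ^ 2 * ((15 / 56 * 0.5931 ^ 2) ^ 2 + 20 * (15 / 56 * 0.5931 ^ 2) ^ 4) := by
    gcongr
  norm_num at h2 h3 hs ⊢
  linarith

lemma le_rpow_div_three {a x : ℝ} (ha : 0 ≤ a) (k : ℕ) (hx : 0 ≤ x) (h : a ^ 3 ≤ x ^ k) :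
    a ≤ x ^ ((k : ℝ) / 3) := by
  have : a = (a ^ 3) ^ ((1 : ℝ) / 3) := by
    rw [← rpow_natCast, ← rpow_mul ha]; norm_num
  rw [this, div_eq_mul_one_div (k : ℝ), rpow_mul hx, rpow_natCast]
  gcongr

lemma collision_bound_ge {y : ℝ} (hy : 0 < y) :
    3 / 4 * 1.2599 * 2.145 + y ^ 2 * (3 / 4 * 1.2599 + 3) ≤
      (3/8) * (16:ℝ) ^ ((1:ℝ)/3) *
        (π ^ ((2:ℝ)/3) + (y ^ 3) ^ ((2:ℝ)/3) + 2 * (2 * y ^ 3) ^ ((2:ℝ)/3)) := by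
  set c : ℝ := 2 ^ ((1 : ℝ) / 3) with hc
  have hc3 : c ^ 3 = 2 := by
    rw [hc, ← rpow_natCast, ← rpow_mul (by norm_num)]; norm_num
  have hcl : 1.2599 ≤ c := by
    have := le_rpow_div_three (a := 1.2599) (x := 2) (by norm_num) 1 (by norm_num) (by norm_num)
    simpa [hc] using this
  have hp : 2.145 ≤ π ^ ((2 : ℝ) / 3) := by
    have := le_rpow_div_three (a := 2.145) (x := π) (by norm_num) 2 pi_pos.le
      (by nlinarith [pi_gt_d6])
    simpa using this
  have h16 : (16 : ℝ) ^ ((1 : ℝ) / 3) = 2 * c := by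
    rw [show (16 : ℝ) = 2 ^ (3 : ℝ) * 2 by norm_num, mul_rpow (by norm_num) (by norm_num),
      ← rpow_mul (by norm_num)]
    norm_num
    rw [hc]
  have hy2 : (y ^ 3) ^ ((2 : ℝ) / 3) = y ^ 2 := by
    rw [← rpow_natCast, ← rpow_mul hy.le, ← rpow_natCast]; norm_num
  have hc2 : (2 : ℝ) ^ ((2 : ℝ) / 3) = c ^ 2 := by
    rw [hc, ← rpow_natCast, ← rpow_mul (by norm_num)]; norm_num
  rw [mul_rpow (by norm_num) (by positivity), hy2, hc2, h16]
  have hcp : 1.2599 * 2.145 ≤ c * π ^ ((2 : ℝ) / 3) := by gcongr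
  have hcy : 1.2599 * y ^ 2 ≤ c * y ^ 2 := by gcongr
  calc _ ≤ 3 / 4 * (c * π ^ ((2 : ℝ) / 3)) + 3 / 4 * (c * y ^ 2) + 3 * y ^ 2 := by linarith
    _ = _ := by linear_combination -(3 / 2 * y ^ 2) * hc3

/-- for `0 < θ ≤ 0.0664·π`, there is a test path in `P(Q_S, Q_{E₂})`
whose action is strictly below `(3/8)·16^{1/3}·[π^{2/3} + θ^{2/3} + 2(2θ)^{2/3}]`. -/
theorem statement19 (θ : ℝ) (hθ0 : 0 < θ) (hθ1 : θ ≤ 0.0664 * π) :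
    ∃ p : H1Path4, inAdm (QE2set θ) p ∧
      action p < ENNReal.ofReal ((3/8) * (16:ℝ) ^ ((1:ℝ)/3) *
        (π ^ ((2:ℝ)/3) + θ ^ ((2:ℝ)/3) + 2 * (2*θ) ^ ((2:ℝ)/3))) := by
  obtain ⟨y, hy, rfl⟩ : ∃ y : ℝ, 0 < y ∧ y ^ 3 = θ :=
    ⟨θ ^ ((1 : ℝ) / 3), by positivity, by
      rw [← rpow_natCast, ← rpow_mul hθ0.le]; norm_num⟩
  have hnum := action_bound_numeric hy hθ1
  have hs : 15 / 56 * y ^ 2 ≤ 1 / 10 := by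
    have hπ := pi_lt_d6
    by_contra! h
    have hy' : 0.6 < y := by nlinarith
    have : (0.6 : ℝ) ^ 3 < y ^ 3 := by gcongr
    norm_num at this hθ1 hπ
    linarith
  refine ⟨binaryTrianglePath (y ^ 3) (π / 2 + y ^ 3) (8 / 5 / y ^ 2)
    (2 * (8 / 5 / y ^ 2) * (15 / 56 * y ^ 2)),
    inAdm_binaryTrianglePath _ (by positivity) (by positivity),
    (action_binaryTrianglePath_le _ (by positivity) (by positivity) hs).trans_lt ?_⟩
  have hge := collision_bound_ge hy
  rw [ENNReal.ofReal_lt_ofReal_iff (lt_of_lt_of_le (by positivity) hge)]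
  refine lt_of_eq_of_lt ?_ (hnum.trans_le hge)
  field_simp
  ring

end
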